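/- Let q > 1 be a real number, let m2 > 0 and E ∈ ℝ. If γ(l) ≥ 0 for all l ∈ ℕ, then there exists N ∈ ℕ such that E² = ⟨N+1⟩_q²·m2. (Energy quantization: for real positive mass squared M² = m2, positivity of the norms forces the recursion to terminate, and the only possible energy eigenvalues are the discrete values E = ±⟨N+1⟩_q·M.) -/

import Mathlib

/-- The q-number [x]_q = (q^x - q^(-x))/(q - q⁻¹). -/
noncomputable def qnum (q x : ℝ) : ℝ := (q ^ x - q ^ (-x)) / (q - q⁻¹)

/-- The symmetric q-number ⟨x⟩_q = (q^x + q^(-x))/(q + q⁻¹). -/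
noncomputable def sqnum (q x : ℝ) : ℝ := (q ^ x + q ^ (-x)) / (q + q⁻¹)

/-- The squared-norm recursion γ(0) = 1,
    γ(l+1) = (q²·[l+1]_q/[2l+3]_q)·(E²/⟨l+1⟩_q − ⟨l+1⟩_q·m2)·γ(l). -/
noncomputable def gam (q E m2 : ℝ) : ℕ → ℝ
  | 0 => 1
  | l + 1 =>
      (q ^ 2 * qnum q ((l : ℝ) + 1) / qnum q (2 * (l : ℝ) + 3)) *
        (E ^ 2 / sqnum q ((l : ℝ) + 1) - sqnum q ((l : ℝ) + 1) * m2) * gam q E m2 l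

theorem qnum_pos {q x : ℝ} (hq : 1 < q) (hx : 0 < x) : 0 < qnum q x :=
  div_pos (sub_pos.2 (Real.rpow_lt_rpow_of_exponent_lt hq (by linarith)))
    (sub_pos.2 ((inv_lt_one_of_one_lt₀ hq).trans hq))

theorem sqnum_pos {q : ℝ} (hq : 0 < q) (x : ℝ) : 0 < sqnum q x := by
  unfold sqnum
  positivity

/-- The symmetric q-numbers at the positive integers are unbounded. -/
theorem exists_lt_sqnum {q : ℝ} (hq : 1 < q) (B : ℝ) :
    ∃ l : ℕ, B < sqnum q ((l : ℝ) + 1) := by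
  have hq0 : 0 < q := zero_lt_one.trans hq
  obtain ⟨n, hn⟩ := pow_unbounded_of_one_lt (B * (q + q⁻¹)) hq
  refine ⟨n, ?_⟩
  rw [sqnum, lt_div_iff₀ (by positivity)]
  have h1 : q ^ n < q ^ ((n : ℝ) + 1) := by
    rw [← Real.rpow_natCast]
    exact Real.rpow_lt_rpow_of_exponent_lt hq (by linarith)
  have h2 : 0 < q ^ (-((n : ℝ) + 1)) := by positivity
  linarith

theorem stmt_2 (q E m2 : ℝ) (hq : 1 < q) (hm : 0 < m2)
    (h : ∀ l : ℕ, 0 ≤ gam q E m2 l) :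
    ∃ N : ℕ, E ^ 2 = (sqnum q ((N : ℝ) + 1)) ^ 2 * m2 := by
  by_contra! hne
  have hq0 : 0 < q := zero_lt_one.trans hq
  have hs (l : ℕ) : 0 < sqnum q ((l : ℝ) + 1) := sqnum_pos hq0 _
  have hc (l : ℕ) : 0 < q ^ 2 * qnum q ((l : ℝ) + 1) / qnum q (2 * (l : ℝ) + 3) :=
    div_pos (mul_pos (by positivity) (qnum_pos hq (by positivity))) (qnum_pos hq (by positivity))
  have hfac (l : ℕ) : E ^ 2 / sqnum q ((l : ℝ) + 1) - sqnum q ((l : ℝ) + 1) * m2 ≠ 0 := by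
    intro h0
    apply hne l
    rw [sub_eq_zero, div_eq_iff (hs l).ne'] at h0
    linarith
  have hgam (l : ℕ) : 0 < gam q E m2 l := by
    refine (h l).lt_of_ne' ?_
    induction l with
    | zero => simp [gam]
    | succ l ih => exact mul_ne_zero (mul_ne_zero (hc l).ne' (hfac l)) ih
  have hbound (l : ℕ) : sqnum q ((l : ℝ) + 1) ^ 2 * m2 ≤ E ^ 2 := by
    have h1 : 0 < E ^ 2 / sqnum q ((l : ℝ) + 1) - sqnum q ((l : ℝ) + 1) * m2 :=
      pos_of_mul_pos_right (pos_of_mul_pos_left (hgam (l + 1)) (hgam l).le) (hc l).le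
    rw [sub_pos, lt_div_iff₀ (hs l)] at h1
    linarith
  obtain ⟨l, hl⟩ := exists_lt_sqnum hq (E ^ 2 / m2 + 1)
  rw [← lt_sub_iff_add_lt, div_lt_iff₀ hm] at hl
  have h2 : sqnum q ((l : ℝ) + 1) - 1 ≤ sqnum q ((l : ℝ) + 1) ^ 2 := by
    nlinarith [sq_nonneg (sqnum q ((l : ℝ) + 1) - 1), hs l]
  linarith [hbound l, mul_le_mul_of_nonneg_right h2 hm.le]
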